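/- Let A be a right weak bimonoid in a duoidal category (M,∘,I,•,J) in which idempotent morphisms split. Then R_∘ is a separable Frobenius monoid in the category of left J-modules: each of the four structure morphisms μ^R_∘ : R_∘•R_∘ → R_∘, η^R_∘ : J → R_∘, Δ^R_∘ : R_∘ → R_∘•R_∘ and ε^R_∘ : R_∘ → J is a morphism of left J-modules, where J acts on R_∘ by γ_J, on J by ϖ, and on R_∘•R_∘ by the composite (γ_J•γ_J).ζ precomposed with the isomorphism J∘(R_∘•R_∘) ≅ (J•J)∘(R_∘•R_∘). -/

import Mathlib

open CategoryTheory

universe v u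

/-- A (strict) duoidal category structure on a category `M`: two strict monoidal
structures `co` (the first monoidal product `∘` with unit `uI`) and `bu` (the second
monoidal product `•` with unit `uJ`), together with the structure morphisms
`dlI : I ⟶ I • I`, `pw : J ∘ J ⟶ J`, `tau : I ⟶ J` and the interchange law `zt`,
subject to the axioms of a duoidal category. -/
structure Duo (M : Type u) [Category.{v} M] where
  co : M → M → M
  coh : ∀ {X₁ Y₁ X₂ Y₂ : M}, (X₁ ⟶ Y₁) → (X₂ ⟶ Y₂) → (co X₁ X₂ ⟶ co Y₁ Y₂)
  uI : M
  bu : M → M → M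
  buh : ∀ {X₁ Y₁ X₂ Y₂ : M}, (X₁ ⟶ Y₁) → (X₂ ⟶ Y₂) → (bu X₁ X₂ ⟶ bu Y₁ Y₂)
  uJ : M
  coA : ∀ X Y Z, co (co X Y) Z = co X (co Y Z)
  coL : ∀ X, co uI X = X
  coR : ∀ X, co X uI = X
  buA : ∀ X Y Z, bu (bu X Y) Z = bu X (bu Y Z)
  buL : ∀ X, bu uJ X = X
  buR : ∀ X, bu X uJ = X
  coh_id : ∀ X Y, coh (𝟙 X) (𝟙 Y) = 𝟙 (co X Y)
  coh_comp : ∀ {X₁ Y₁ Z₁ X₂ Y₂ Z₂ : M} (f₁ : X₁ ⟶ Y₁) (g₁ : Y₁ ⟶ Z₁) (f₂ : X₂ ⟶ Y₂)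
    (g₂ : Y₂ ⟶ Z₂), coh (f₁ ≫ g₁) (f₂ ≫ g₂) = coh f₁ f₂ ≫ coh g₁ g₂
  buh_id : ∀ X Y, buh (𝟙 X) (𝟙 Y) = 𝟙 (bu X Y)
  buh_comp : ∀ {X₁ Y₁ Z₁ X₂ Y₂ Z₂ : M} (f₁ : X₁ ⟶ Y₁) (g₁ : Y₁ ⟶ Z₁) (f₂ : X₂ ⟶ Y₂)
    (g₂ : Y₂ ⟶ Z₂), buh (f₁ ≫ g₁) (f₂ ≫ g₂) = buh f₁ f₂ ≫ buh g₁ g₂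
  coh_assoc : ∀ {X₁ Y₁ X₂ Y₂ X₃ Y₃ : M} (f₁ : X₁ ⟶ Y₁) (f₂ : X₂ ⟶ Y₂) (f₃ : X₃ ⟶ Y₃),
    coh (coh f₁ f₂) f₃
      = eqToHom (coA X₁ X₂ X₃) ≫ coh f₁ (coh f₂ f₃) ≫ eqToHom (coA Y₁ Y₂ Y₃).symm
  coh_unitL : ∀ {X Y : M} (f : X ⟶ Y),
    coh (𝟙 uI) f = eqToHom (coL X) ≫ f ≫ eqToHom (coL Y).symm
  coh_unitR : ∀ {X Y : M} (f : X ⟶ Y),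
    coh f (𝟙 uI) = eqToHom (coR X) ≫ f ≫ eqToHom (coR Y).symm
  buh_assoc : ∀ {X₁ Y₁ X₂ Y₂ X₃ Y₃ : M} (f₁ : X₁ ⟶ Y₁) (f₂ : X₂ ⟶ Y₂) (f₃ : X₃ ⟶ Y₃),
    buh (buh f₁ f₂) f₃
      = eqToHom (buA X₁ X₂ X₃) ≫ buh f₁ (buh f₂ f₃) ≫ eqToHom (buA Y₁ Y₂ Y₃).symm
  buh_unitL : ∀ {X Y : M} (f : X ⟶ Y),
    buh (𝟙 uJ) f = eqToHom (buL X) ≫ f ≫ eqToHom (buL Y).symm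
  buh_unitR : ∀ {X Y : M} (f : X ⟶ Y),
    buh f (𝟙 uJ) = eqToHom (buR X) ≫ f ≫ eqToHom (buR Y).symm
  dlI : uI ⟶ bu uI uI
  pw : co uJ uJ ⟶ uJ
  tau : uI ⟶ uJ
  zt : ∀ A B C D : M, co (bu A B) (bu C D) ⟶ bu (co A C) (co B D)
  zt_nat : ∀ {A A' B B' C C' D D' : M} (f : A ⟶ A') (g : B ⟶ B') (h : C ⟶ C')
    (k : D ⟶ D'),
    coh (buh f g) (buh h k) ≫ zt A' B' C' D' = zt A B C D ≫ buh (coh f h) (coh g k)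
  pw_assoc : coh pw (𝟙 uJ) ≫ pw = eqToHom (coA uJ uJ uJ) ≫ coh (𝟙 uJ) pw ≫ pw
  pw_unitL : eqToHom (coL uJ).symm ≫ coh tau (𝟙 uJ) ≫ pw = 𝟙 uJ
  pw_unitR : eqToHom (coR uJ).symm ≫ coh (𝟙 uJ) tau ≫ pw = 𝟙 uJ
  dlI_coassoc : dlI ≫ buh dlI (𝟙 uI) ≫ eqToHom (buA uI uI uI) = dlI ≫ buh (𝟙 uI) dlI
  dlI_counitL : dlI ≫ buh tau (𝟙 uI) ≫ eqToHom (buL uI) = 𝟙 uI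
  dlI_counitR : dlI ≫ buh (𝟙 uI) tau ≫ eqToHom (buR uI) = 𝟙 uI
  zt_assoc1 : ∀ A B C D E F : M,
    coh (zt A B C D) (𝟙 (bu E F)) ≫ zt (co A C) (co B D) E F
      = eqToHom (coA (bu A B) (bu C D) (bu E F)) ≫ coh (𝟙 (bu A B)) (zt C D E F)
          ≫ zt A B (co C E) (co D F)
          ≫ eqToHom (show bu (co A (co C E)) (co B (co D F))
              = bu (co (co A C) E) (co (co B D) F) by simp [coA])
  zt_assoc2 : ∀ A B C D E F : M,
    zt (bu A B) C (bu D E) F ≫ buh (zt A B D E) (𝟙 (co C F))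
      = eqToHom (show co (bu (bu A B) C) (bu (bu D E) F)
            = co (bu A (bu B C)) (bu D (bu E F)) by simp [buA])
          ≫ zt A (bu B C) D (bu E F) ≫ buh (𝟙 (co A D)) (zt B C E F)
          ≫ eqToHom (buA (co A D) (co B E) (co C F)).symm
  zt_unitA : ∀ A B : M,
    eqToHom (coL (bu A B)).symm ≫ coh dlI (𝟙 (bu A B)) ≫ zt uI uI A B
      ≫ eqToHom (show bu (co uI A) (co uI B) = bu A B by simp [coL]) = 𝟙 (bu A B)
  zt_unitB : ∀ A B : M,
    eqToHom (coR (bu A B)).symm ≫ coh (𝟙 (bu A B)) dlI ≫ zt A B uI uI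
      ≫ eqToHom (show bu (co A uI) (co B uI) = bu A B by simp [coR]) = 𝟙 (bu A B)
  zt_unitC : ∀ A B : M,
    eqToHom (show co A B = co (bu uJ A) (bu uJ B) by simp [buL]) ≫ zt uJ A uJ B
      ≫ buh pw (𝟙 (co A B)) ≫ eqToHom (buL (co A B)) = 𝟙 (co A B)
  zt_unitD : ∀ A B : M,
    eqToHom (show co A B = co (bu A uJ) (bu B uJ) by simp [buR]) ≫ zt A uJ B uJ
      ≫ buh (𝟙 (co A B)) pw ≫ eqToHom (buR (co A B)) = 𝟙 (co A B)

namespace Duo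

variable {M : Type u} [Category.{v} M] (D : Duo M)

/-- Axiom (WB): the multiplication is comultiplicative. -/
def WBeq (A : M) (mu : D.co A A ⟶ A) (dl : A ⟶ D.bu A A) : Prop :=
  mu ≫ dl = D.coh dl dl ≫ D.zt A A A A ≫ D.buh mu mu

/-- Axiom (RRU). -/
def RRUeq (A : M) (mu : D.co A A ⟶ A) (eta : D.uI ⟶ A) (dl : A ⟶ D.bu A A) : Prop :=
  D.dlI ≫ D.buh (𝟙 D.uI) (eta ≫ dl)
    ≫ eqToHom (show D.bu D.uI (D.bu A A) = D.bu (D.co (D.bu D.uI A) D.uI) A by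
        simp [D.coR, D.buA])
    ≫ D.buh (D.coh (𝟙 (D.bu D.uI A)) D.dlI) (𝟙 A)
    ≫ D.buh (D.coh (𝟙 (D.bu D.uI A)) (D.buh (𝟙 D.uI) (eta ≫ dl))) (𝟙 A)
    ≫ eqToHom (show D.bu (D.co (D.bu D.uI A) (D.bu D.uI (D.bu A A))) A
        = D.bu (D.co (D.bu D.uI A) (D.bu (D.bu D.uI A) A)) A by simp [D.buA])
    ≫ D.buh (D.zt D.uI A (D.bu D.uI A) A) (𝟙 A)
    ≫ eqToHom (show D.bu (D.bu (D.co D.uI (D.bu D.uI A)) (D.co A A)) A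
        = D.bu (D.bu (D.bu D.uI A) (D.co A A)) A by simp [D.coL])
    ≫ D.buh (D.buh (𝟙 (D.bu D.uI A)) mu) (𝟙 A)
  = D.dlI ≫ D.buh (𝟙 D.uI) eta ≫ D.buh (𝟙 D.uI) dl
    ≫ eqToHom (show D.bu D.uI (D.bu A A) = D.bu (D.bu D.uI A) A by simp [D.buA])
    ≫ D.buh (𝟙 (D.bu D.uI A)) dl
    ≫ eqToHom (show D.bu (D.bu D.uI A) (D.bu A A)
        = D.bu (D.bu (D.bu D.uI A) A) A by simp [D.buA])

/-- Axiom (LRU). -/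
def LRUeq (A : M) (mu : D.co A A ⟶ A) (eta : D.uI ⟶ A) (dl : A ⟶ D.bu A A) : Prop :=
  D.dlI ≫ D.buh (eta ≫ dl) (𝟙 D.uI)
    ≫ eqToHom (show D.bu (D.bu A A) D.uI = D.bu A (D.co (D.bu A D.uI) D.uI) by
        simp [D.coR, D.buA])
    ≫ D.buh (𝟙 A) (D.coh (𝟙 (D.bu A D.uI)) D.dlI)
    ≫ D.buh (𝟙 A) (D.coh (𝟙 (D.bu A D.uI)) (D.buh (eta ≫ dl) (𝟙 D.uI)))
    ≫ eqToHom (show D.bu A (D.co (D.bu A D.uI) (D.bu (D.bu A A) D.uI))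
        = D.bu A (D.co (D.bu A D.uI) (D.bu A (D.bu A D.uI))) by simp [D.buA])
    ≫ D.buh (𝟙 A) (D.zt A D.uI A (D.bu A D.uI))
    ≫ eqToHom (show D.bu A (D.bu (D.co A A) (D.co D.uI (D.bu A D.uI)))
        = D.bu (D.bu (D.bu A (D.co A A)) A) D.uI by simp [D.coL, D.buA])
    ≫ D.buh (D.buh (D.buh (𝟙 A) mu) (𝟙 A)) (𝟙 D.uI)
  = D.dlI ≫ D.buh eta (𝟙 D.uI) ≫ D.buh dl (𝟙 D.uI) ≫ D.buh (D.buh dl (𝟙 A)) (𝟙 D.uI)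

/-- Axiom (LRC). -/
def LRCeq (A : M) (mu : D.co A A ⟶ A) (dl : A ⟶ D.bu A A) (ep : A ⟶ D.uJ) : Prop :=
  D.coh (D.coh (𝟙 (D.co D.uJ A)) dl) (𝟙 A)
    ≫ eqToHom (show D.co (D.co (D.co D.uJ A) (D.bu A A)) A
        = D.co (D.co (D.bu (D.co D.uJ A) D.uJ) (D.bu A A)) A by simp [D.buR])
    ≫ D.coh (D.zt (D.co D.uJ A) D.uJ A A) (𝟙 A)
    ≫ D.coh (D.buh (eqToHom (D.coA D.uJ A A) ≫ D.coh (𝟙 D.uJ) (mu ≫ ep))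
        (𝟙 (D.co D.uJ A))) (𝟙 A)
    ≫ D.coh (D.buh D.pw (𝟙 (D.co D.uJ A))) (𝟙 A)
    ≫ eqToHom (show D.co (D.bu D.uJ (D.co D.uJ A)) A = D.co D.uJ (D.co A A) by
        simp [D.buL, D.coA])
    ≫ D.coh (𝟙 D.uJ) (mu ≫ ep) ≫ D.pw
  = eqToHom (show D.co (D.co (D.co D.uJ A) A) A = D.co (D.co D.uJ A) (D.co A A) by
        simp [D.coA])
    ≫ D.coh (𝟙 (D.co D.uJ A)) mu
    ≫ eqToHom (D.coA D.uJ A A)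
    ≫ D.coh (𝟙 D.uJ) mu ≫ D.coh (𝟙 D.uJ) ep ≫ D.pw

/-- Axiom (LLC). -/
def LLCeq (A : M) (mu : D.co A A ⟶ A) (dl : A ⟶ D.bu A A) (ep : A ⟶ D.uJ) : Prop :=
  D.coh (D.coh (𝟙 (D.co D.uJ A)) dl) (𝟙 A)
    ≫ eqToHom (show D.co (D.co (D.co D.uJ A) (D.bu A A)) A
        = D.co (D.co (D.bu D.uJ (D.co D.uJ A)) (D.bu A A)) A by simp [D.buL])
    ≫ D.coh (D.zt D.uJ (D.co D.uJ A) A A) (𝟙 A)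
    ≫ D.coh (D.buh (𝟙 (D.co D.uJ A))
        (eqToHom (D.coA D.uJ A A) ≫ D.coh (𝟙 D.uJ) (mu ≫ ep))) (𝟙 A)
    ≫ D.coh (D.buh (𝟙 (D.co D.uJ A)) D.pw) (𝟙 A)
    ≫ eqToHom (show D.co (D.bu (D.co D.uJ A) D.uJ) A = D.co D.uJ (D.co A A) by
        simp [D.buR, D.coA])
    ≫ D.coh (𝟙 D.uJ) (mu ≫ ep) ≫ D.pw
  = eqToHom (show D.co (D.co (D.co D.uJ A) A) A = D.co (D.co D.uJ A) (D.co A A) by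
        simp [D.coA])
    ≫ D.coh (𝟙 (D.co D.uJ A)) mu
    ≫ eqToHom (D.coA D.uJ A A)
    ≫ D.coh (𝟙 D.uJ) mu ≫ D.coh (𝟙 D.uJ) ep ≫ D.pw

/-- Axiom (RLU), obtained from (RRU) by replacing `∘` by its opposite. -/
def RLUeq (A : M) (mu : D.co A A ⟶ A) (eta : D.uI ⟶ A) (dl : A ⟶ D.bu A A) : Prop :=
  D.dlI ≫ D.buh (𝟙 D.uI) (eta ≫ dl)
    ≫ eqToHom (show D.bu D.uI (D.bu A A) = D.bu (D.co D.uI (D.bu D.uI A)) A by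
        simp [D.coL, D.buA])
    ≫ D.buh (D.coh D.dlI (𝟙 (D.bu D.uI A))) (𝟙 A)
    ≫ D.buh (D.coh (D.buh (𝟙 D.uI) (eta ≫ dl)) (𝟙 (D.bu D.uI A))) (𝟙 A)
    ≫ eqToHom (show D.bu (D.co (D.bu D.uI (D.bu A A)) (D.bu D.uI A)) A
        = D.bu (D.co (D.bu (D.bu D.uI A) A) (D.bu D.uI A)) A by simp [D.buA])
    ≫ D.buh (D.zt (D.bu D.uI A) A D.uI A) (𝟙 A)
    ≫ eqToHom (show D.bu (D.bu (D.co (D.bu D.uI A) D.uI) (D.co A A)) A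
        = D.bu (D.bu (D.bu D.uI A) (D.co A A)) A by simp [D.coR])
    ≫ D.buh (D.buh (𝟙 (D.bu D.uI A)) mu) (𝟙 A)
  = D.dlI ≫ D.buh (𝟙 D.uI) eta ≫ D.buh (𝟙 D.uI) dl
    ≫ eqToHom (show D.bu D.uI (D.bu A A) = D.bu (D.bu D.uI A) A by simp [D.buA])
    ≫ D.buh (𝟙 (D.bu D.uI A)) dl
    ≫ eqToHom (show D.bu (D.bu D.uI A) (D.bu A A)
        = D.bu (D.bu (D.bu D.uI A) A) A by simp [D.buA])

/-- Axiom (LLU), obtained from (LRU) by replacing `∘` by its opposite. -/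
def LLUeq (A : M) (mu : D.co A A ⟶ A) (eta : D.uI ⟶ A) (dl : A ⟶ D.bu A A) : Prop :=
  D.dlI ≫ D.buh (eta ≫ dl) (𝟙 D.uI)
    ≫ eqToHom (show D.bu (D.bu A A) D.uI = D.bu A (D.co D.uI (D.bu A D.uI)) by
        simp [D.coL, D.buA])
    ≫ D.buh (𝟙 A) (D.coh D.dlI (𝟙 (D.bu A D.uI)))
    ≫ D.buh (𝟙 A) (D.coh (D.buh (eta ≫ dl) (𝟙 D.uI)) (𝟙 (D.bu A D.uI)))
    ≫ eqToHom (show D.bu A (D.co (D.bu (D.bu A A) D.uI) (D.bu A D.uI))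
        = D.bu A (D.co (D.bu A (D.bu A D.uI)) (D.bu A D.uI)) by simp [D.buA])
    ≫ D.buh (𝟙 A) (D.zt A (D.bu A D.uI) A D.uI)
    ≫ eqToHom (show D.bu A (D.bu (D.co A A) (D.co (D.bu A D.uI) D.uI))
        = D.bu (D.bu (D.bu A (D.co A A)) A) D.uI by simp [D.coR, D.buA])
    ≫ D.buh (D.buh (D.buh (𝟙 A) mu) (𝟙 A)) (𝟙 D.uI)
  = D.dlI ≫ D.buh eta (𝟙 D.uI) ≫ D.buh dl (𝟙 D.uI) ≫ D.buh (D.buh dl (𝟙 A)) (𝟙 D.uI)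

/-- Axiom (RRC), obtained from (LLC) by replacing `∘` by its opposite. -/
def RRCeq (A : M) (mu : D.co A A ⟶ A) (dl : A ⟶ D.bu A A) (ep : A ⟶ D.uJ) : Prop :=
  D.coh (D.coh (D.coh (𝟙 A) dl) (𝟙 A)) (𝟙 D.uJ)
    ≫ eqToHom (show D.co (D.co (D.co A (D.bu A A)) A) D.uJ
        = D.co A (D.co (D.bu A A) (D.bu (D.co A D.uJ) D.uJ)) by simp [D.coA, D.buR])
    ≫ D.coh (𝟙 A) (D.zt A A (D.co A D.uJ) D.uJ)
    ≫ D.coh (𝟙 A) (D.buh (eqToHom (D.coA A A D.uJ).symm ≫ D.coh (mu ≫ ep) (𝟙 D.uJ))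
        (𝟙 (D.co A D.uJ)))
    ≫ D.coh (𝟙 A) (D.buh D.pw (𝟙 (D.co A D.uJ)))
    ≫ eqToHom (show D.co A (D.bu D.uJ (D.co A D.uJ)) = D.co (D.co A A) D.uJ by
        simp [D.buL, D.coA])
    ≫ D.coh (mu ≫ ep) (𝟙 D.uJ) ≫ D.pw
  = D.coh (D.coh mu (𝟙 A)) (𝟙 D.uJ) ≫ D.coh mu (𝟙 D.uJ) ≫ D.coh ep (𝟙 D.uJ) ≫ D.pw

/-- Axiom (RLC), obtained from (LRC) by replacing `∘` by its opposite. -/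
def RLCeq (A : M) (mu : D.co A A ⟶ A) (dl : A ⟶ D.bu A A) (ep : A ⟶ D.uJ) : Prop :=
  D.coh (D.coh (D.coh (𝟙 A) dl) (𝟙 A)) (𝟙 D.uJ)
    ≫ eqToHom (show D.co (D.co (D.co A (D.bu A A)) A) D.uJ
        = D.co A (D.co (D.bu A A) (D.bu D.uJ (D.co A D.uJ))) by simp [D.coA, D.buL])
    ≫ D.coh (𝟙 A) (D.zt A A D.uJ (D.co A D.uJ))
    ≫ D.coh (𝟙 A) (D.buh (𝟙 (D.co A D.uJ))
        (eqToHom (D.coA A A D.uJ).symm ≫ D.coh (mu ≫ ep) (𝟙 D.uJ)))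
    ≫ D.coh (𝟙 A) (D.buh (𝟙 (D.co A D.uJ)) D.pw)
    ≫ eqToHom (show D.co A (D.bu (D.co A D.uJ) D.uJ) = D.co (D.co A A) D.uJ by
        simp [D.buR, D.coA])
    ≫ D.coh (mu ≫ ep) (𝟙 D.uJ) ≫ D.pw
  = D.coh (D.coh mu (𝟙 A)) (𝟙 D.uJ) ≫ D.coh mu (𝟙 D.uJ) ≫ D.coh ep (𝟙 D.uJ) ≫ D.pw

end Duo

/-- A right weak bimonoid in a duoidal category. -/
structure RWB {M : Type u} [Category.{v} M] (D : Duo M) where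
  A : M
  mu : D.co A A ⟶ A
  eta : D.uI ⟶ A
  dl : A ⟶ D.bu A A
  ep : A ⟶ D.uJ
  mu_assoc : D.coh mu (𝟙 A) ≫ mu = eqToHom (D.coA A A A) ≫ D.coh (𝟙 A) mu ≫ mu
  mu_unitL : eqToHom (D.coL A).symm ≫ D.coh eta (𝟙 A) ≫ mu = 𝟙 A
  mu_unitR : eqToHom (D.coR A).symm ≫ D.coh (𝟙 A) eta ≫ mu = 𝟙 A
  dl_coassoc : dl ≫ D.buh dl (𝟙 A) ≫ eqToHom (D.buA A A A) = dl ≫ D.buh (𝟙 A) dl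
  dl_counitL : dl ≫ D.buh ep (𝟙 A) ≫ eqToHom (D.buL A) = 𝟙 A
  dl_counitR : dl ≫ D.buh (𝟙 A) ep ≫ eqToHom (D.buR A) = 𝟙 A
  wb : D.WBeq A mu dl
  rru : D.RRUeq A mu eta dl
  lru : D.LRUeq A mu eta dl
  lrc : D.LRCeq A mu dl ep
  llc : D.LLCeq A mu dl ep

/-- A weak bimonoid: both a right weak bimonoid and a left weak bimonoid. -/
structure WBim {M : Type u} [Category.{v} M] (D : Duo M) extends RWB D where
  rlu : D.RLUeq A mu eta dl
  llu : D.LLUeq A mu eta dl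
  rlc : D.RLCeq A mu dl ep
  rrc : D.RRCeq A mu dl ep

/-- Idempotent morphisms split in `M`. -/
def SplitIdem (M : Type u) [Category.{v} M] : Prop :=
  ∀ ⦃X : M⦄ (e : X ⟶ X), e ≫ e = e →
    ∃ (Y : M) (p : X ⟶ Y) (i : Y ⟶ X), p ≫ i = e ∧ i ≫ p = 𝟙 Y

namespace RWB

variable {M : Type u} [Category.{v} M] {D : Duo M} (W : RWB D)

/-- The object `J∘A`. -/
def JA : M := D.co D.uJ W.A

/-- The idempotent morphism `⊓^R_∘ :=
((J∘A)•ϖ).((J∘A)•(J∘(ε.μ))).ζ.(J∘A∘(Δ.η)) : J∘A ⟶ J∘A`. -/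
def sqcapR : W.JA ⟶ W.JA :=
  eqToHom (show W.JA = D.co W.JA D.uI by simp [D.coR])
    ≫ D.coh (𝟙 W.JA) (W.eta ≫ W.dl)
    ≫ eqToHom (show D.co W.JA (D.bu W.A W.A)
        = D.co (D.bu D.uJ W.JA) (D.bu W.A W.A) by simp [D.buL])
    ≫ D.zt D.uJ W.JA W.A W.A
    ≫ D.buh (𝟙 W.JA) (eqToHom (D.coA D.uJ W.A W.A) ≫ D.coh (𝟙 D.uJ) (W.mu ≫ W.ep))
    ≫ D.buh (𝟙 W.JA) D.pw
    ≫ eqToHom (D.buR W.JA)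

/-- The natural idempotent `χ^R_{F,G} = (φ•γ).ζ.((F•G)∘(Δ.η))` on `F•G`, for right
`A`-modules `(F,f)` and `(G,g)`. -/
def chiR (F G : M) (f : D.co F W.A ⟶ F) (g : D.co G W.A ⟶ G) :
    D.bu F G ⟶ D.bu F G :=
  eqToHom (show D.bu F G = D.co (D.bu F G) D.uI by simp [D.coR])
    ≫ D.coh (𝟙 (D.bu F G)) (W.eta ≫ W.dl)
    ≫ D.zt F G W.A W.A
    ≫ D.buh f g

/-- The morphism `J∘η : J ⟶ J∘A`. -/
def jeta : D.uJ ⟶ W.JA :=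
  eqToHom (D.coR D.uJ).symm ≫ D.coh (𝟙 D.uJ) W.eta

/-- The morphism `(π^R_∘).(τ∘A) : A ⟶ R_∘` needs `τ∘A : A ⟶ J∘A`. -/
def tauA : W.A ⟶ W.JA :=
  eqToHom (D.coL W.A).symm ≫ D.coh D.tau (𝟙 W.A)

section Retract

variable (R : M) (p : W.JA ⟶ R) (i : R ⟶ W.JA)

/-- The right `A`-action `γ_A = π^R_∘.(J∘μ).(ι^R_∘ ∘ A)` on the retract `R_∘`. -/
def gamA : D.co R W.A ⟶ R :=
  D.coh i (𝟙 W.A) ≫ eqToHom (D.coA D.uJ W.A W.A) ≫ D.coh (𝟙 D.uJ) W.mu ≫ p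

/-- The left `J`-action `γ_J = π^R_∘.(ϖ∘A).(J∘ι^R_∘)` on the retract `R_∘`. -/
def gamJ : D.co D.uJ R ⟶ R :=
  D.coh (𝟙 D.uJ) i ≫ eqToHom (D.coA D.uJ D.uJ W.A).symm ≫ D.coh D.pw (𝟙 W.A) ≫ p

/-- The multiplication `μ^R_∘ = (R∘•ϖ).(R∘•(J∘ε)).(R∘•ι^R_∘).χ^R_{R∘,R∘}`. -/
def muR : D.bu R R ⟶ R :=
  W.chiR R R (W.gamA R p i) (W.gamA R p i)
    ≫ D.buh (𝟙 R) i
    ≫ D.buh (𝟙 R) (D.coh (𝟙 D.uJ) W.ep)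
    ≫ D.buh (𝟙 R) D.pw
    ≫ eqToHom (D.buR R)

/-- The unit `η^R_∘ = π^R_∘.(J∘η)`. -/
def etaR : D.uJ ⟶ R := W.jeta ≫ p

/-- The comultiplication `Δ^R_∘ = χ^R_{R∘,R∘}.(R∘•π^R_∘).(R∘•(J∘η))`. -/
def DeltaR : R ⟶ D.bu R R :=
  eqToHom (D.buR R).symm
    ≫ D.buh (𝟙 R) W.jeta
    ≫ D.buh (𝟙 R) p
    ≫ W.chiR R R (W.gamA R p i) (W.gamA R p i)

/-- The counit `ε^R_∘ = ϖ.(J∘ε).ι^R_∘`. -/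
def epsR : R ⟶ D.uJ := i ≫ D.coh (𝟙 D.uJ) W.ep ≫ D.pw

end Retract

/-- The comultiplication-type morphism `ζ.(J∘Δ) : J∘A ⟶ (J∘A)•(J∘A)`. -/
def coact0 : W.JA ⟶ D.bu W.JA W.JA :=
  D.coh (𝟙 D.uJ) W.dl
    ≫ eqToHom (show D.co D.uJ (D.bu W.A W.A)
        = D.co (D.bu D.uJ D.uJ) (D.bu W.A W.A) by simp [D.buL])
    ≫ D.zt D.uJ D.uJ W.A W.A

end RWB

namespace Duo

variable {M : Type u} [Category.{v} M] (D : Duo M)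

lemma coh_eqToHom {X X' Y Y' : M} (h : X = X') (k : Y = Y') :
    D.coh (eqToHom h) (eqToHom k) = eqToHom (by rw [h, k]) := by
  subst h k
  simp [D.coh_id]

lemma buh_eqToHom {X X' Y Y' : M} (h : X = X') (k : Y = Y') :
    D.buh (eqToHom h) (eqToHom k) = eqToHom (by rw [h, k]) := by
  subst h k
  simp [D.buh_id]

lemma coh_id_comp_eqToHom {X X' Y Y' : M} (h : X = X') (f : Y ⟶ Y') :
    D.coh (𝟙 X) f ≫ eqToHom (congrArg (D.co · Y') h)
      = eqToHom (congrArg (D.co · Y) h) ≫ D.coh (𝟙 X') f := by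
  subst h
  simp

lemma coh_eqToHom_comp {X X' Y Z Z' : M} (h : X = X') (f : X' ⟶ Y) (g : Z ⟶ Z') :
    D.coh (eqToHom h ≫ f) g = eqToHom (congrArg (D.co · Z) h) ≫ D.coh f g := by
  subst h
  simp

/-- The morphism `f` commutes with the left `J`-actions `a` and `b`. -/
def JLinear {X Y : M} (a : D.co D.uJ X ⟶ X) (b : D.co D.uJ Y ⟶ Y) (f : X ⟶ Y) : Prop :=
  D.coh (𝟙 D.uJ) f ≫ b = a ≫ f

/-- The left `J`-action on `X • Y` induced by left `J`-actions on `X` and `Y`. -/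
def buAct {X Y : M} (a : D.co D.uJ X ⟶ X) (b : D.co D.uJ Y ⟶ Y) :
    D.co D.uJ (D.bu X Y) ⟶ D.bu X Y :=
  eqToHom (show D.co D.uJ (D.bu X Y) = D.co (D.bu D.uJ D.uJ) (D.bu X Y) by
      simp [D.buL])
    ≫ D.zt D.uJ D.uJ X Y ≫ D.buh a b

/-- The left `J`-action on `X ∘ C` induced by a left `J`-action on `X`. -/
def coAct {X : M} (a : D.co D.uJ X ⟶ X) (C : M) : D.co D.uJ (D.co X C) ⟶ D.co X C :=
  eqToHom (D.coA D.uJ X C).symm ≫ D.coh a (𝟙 C)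

variable {D}

namespace JLinear

variable {X Y Z X' Y' : M} {a : D.co D.uJ X ⟶ X} {b : D.co D.uJ Y ⟶ Y}
  {c : D.co D.uJ Z ⟶ Z} {a' : D.co D.uJ X' ⟶ X'} {b' : D.co D.uJ Y' ⟶ Y'}

lemma id (a : D.co D.uJ X ⟶ X) : D.JLinear a a (𝟙 X) := by
  simp [JLinear, D.coh_id]

lemma comp {f : X ⟶ Y} {g : Y ⟶ Z} (hf : D.JLinear a b f) (hg : D.JLinear b c g) :
    D.JLinear a c (f ≫ g) := by
  unfold JLinear at *
  rw [← Category.comp_id (𝟙 D.uJ), D.coh_comp, Category.assoc, hg, reassoc_of% hf]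

lemma inv {f : X ⟶ Y} {g : Y ⟶ X} (hf : D.JLinear a b f) (hgf : g ≫ f = 𝟙 Y)
    (hfg : f ≫ g = 𝟙 X) : D.JLinear b a g := by
  unfold JLinear at *
  have h : D.coh (𝟙 D.uJ) g ≫ D.coh (𝟙 D.uJ) f = 𝟙 _ := by
    rw [← D.coh_comp, hgf, Category.comp_id, D.coh_id]
  calc D.coh (𝟙 D.uJ) g ≫ a = D.coh (𝟙 D.uJ) g ≫ (a ≫ f) ≫ g := by simp [hfg]
    _ = b ≫ g := by rw [← hf, Category.assoc, reassoc_of% h]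

lemma retract_proj {e : X ⟶ X} (he : D.JLinear a a e) {p : X ⟶ Z} {i : Z ⟶ X}
    (hpi : p ≫ i = e) (hip : i ≫ p = 𝟙 Z) :
    D.JLinear a (D.coh (𝟙 D.uJ) i ≫ a ≫ p) p := by
  have h : D.coh (𝟙 D.uJ) p ≫ D.coh (𝟙 D.uJ) i = D.coh (𝟙 D.uJ) e := by
    rw [← D.coh_comp, hpi, Category.comp_id]
  unfold JLinear at *
  rw [reassoc_of% h, reassoc_of% he, ← hpi, Category.assoc, hip, Category.comp_id]

lemma retract_incl {e : X ⟶ X} (he : D.JLinear a a e) {p : X ⟶ Z} {i : Z ⟶ X}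
    (hpi : p ≫ i = e) (hip : i ≫ p = 𝟙 Z) :
    D.JLinear (D.coh (𝟙 D.uJ) i ≫ a ≫ p) a i := by
  have h : D.coh (𝟙 D.uJ) i ≫ D.coh (𝟙 D.uJ) e = D.coh (𝟙 D.uJ) i := by
    rw [← D.coh_comp, ← hpi, reassoc_of% hip, Category.comp_id]
  unfold JLinear at *
  rw [Category.assoc, Category.assoc, hpi, ← he, reassoc_of% h]

lemma buh {f : X ⟶ X'} {g : Y ⟶ Y'} (hf : D.JLinear a a' f) (hg : D.JLinear b b' g) :
    D.JLinear (D.buAct a b) (D.buAct a' b') (D.buh f g) := by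
  unfold JLinear buAct at *
  have h := D.coh_id_comp_eqToHom (D.buL D.uJ).symm (D.buh f g)
  rw [reassoc_of% h, ← D.buh_id, reassoc_of% D.zt_nat, ← D.buh_comp, hf, hg]
  simp only [Category.assoc, D.buh_comp]

lemma coh {f : X ⟶ Y} (hf : D.JLinear a b f) {C C' : M} (g : C ⟶ C') :
    D.JLinear (D.coAct a C) (D.coAct b C') (D.coh f g) := by
  unfold JLinear coAct at *
  have h := D.coh_assoc (𝟙 D.uJ) f g
  have h' : D.coh (𝟙 D.uJ) (D.coh f g) ≫ eqToHom (D.coA D.uJ Y C').symm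
      = eqToHom (D.coA D.uJ X C).symm ≫ D.coh (D.coh (𝟙 D.uJ) f) g := by
    simp [h]
  rw [reassoc_of% h', ← D.coh_comp, hf, Category.assoc, ← D.coh_comp, Category.comp_id,
    Category.id_comp]

lemma coR (a : D.co D.uJ X ⟶ X) :
    D.JLinear (D.coAct a D.uI) a (eqToHom (D.coR X)) := by
  unfold JLinear coAct
  rw [D.coh_unitR, ← eqToHom_refl _ rfl, D.coh_eqToHom]
  simp

lemma buR (a : D.co D.uJ X ⟶ X) :
    D.JLinear (D.buAct a D.pw) a (eqToHom (D.buR X)) := by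
  unfold JLinear buAct
  have h : D.buh a D.pw = D.buh (𝟙 _) D.pw ≫ D.buh a (𝟙 _) := by
    rw [← D.buh_comp, Category.id_comp, Category.comp_id]
  have h' : D.zt D.uJ D.uJ X D.uJ ≫ D.buh (𝟙 (D.co D.uJ X)) D.pw
      = eqToHom (show D.co (D.bu D.uJ D.uJ) (D.bu X D.uJ) = D.bu (D.co D.uJ X) D.uJ by
          simp [D.buR]) := by
    have := D.zt_unitD D.uJ X
    rw [← cancel_epi (eqToHom (show D.co D.uJ X = D.co (D.bu D.uJ D.uJ) (D.bu X D.uJ) by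
      simp [D.buR])), ← cancel_mono (eqToHom (D.buR (D.co D.uJ X)))]
    simpa using this
  rw [h, D.buh_unitR, ← eqToHom_refl _ rfl, D.coh_eqToHom]
  simp [reassoc_of% h']

lemma buL (a : D.co D.uJ X ⟶ X) :
    D.JLinear (D.buAct D.pw a) a (eqToHom (D.buL X)) := by
  unfold JLinear buAct
  have h : D.buh D.pw a = D.buh D.pw (𝟙 _) ≫ D.buh (𝟙 _) a := by
    rw [← D.buh_comp, Category.id_comp, Category.comp_id]
  have h' : D.zt D.uJ D.uJ D.uJ X ≫ D.buh D.pw (𝟙 (D.co D.uJ X))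
      = eqToHom (show D.co (D.bu D.uJ D.uJ) (D.bu D.uJ X) = D.bu D.uJ (D.co D.uJ X) by
          simp [D.buL]) := by
    have := D.zt_unitC D.uJ X
    rw [← cancel_epi (eqToHom (show D.co D.uJ X = D.co (D.bu D.uJ D.uJ) (D.bu D.uJ X) by
      simp [D.buL])), ← cancel_mono (eqToHom (D.buL (D.co D.uJ X)))]
    simpa using this
  rw [h, D.buh_unitL, ← eqToHom_refl _ rfl, D.coh_eqToHom]
  simp [reassoc_of% h']

lemma zt (a : D.co D.uJ X ⟶ X) (b : D.co D.uJ Y ⟶ Y) (C E : M) :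
    D.JLinear (D.coAct (D.buAct a b) (D.bu C E)) (D.buAct (D.coAct a C) (D.coAct b E))
      (D.zt X Y C E) := by
  unfold JLinear coAct buAct
  have h := D.coh_id_comp_eqToHom (D.buL D.uJ).symm (D.zt X Y C E)
  have hL : D.coh (eqToHom (show D.co D.uJ (D.bu X Y) = D.co (D.bu D.uJ D.uJ) (D.bu X Y) by
        simp [D.buL]) ≫ D.zt D.uJ D.uJ X Y ≫ D.buh a b) (𝟙 (D.bu C E))
      = eqToHom (show D.co (D.co D.uJ (D.bu X Y)) (D.bu C E)
          = D.co (D.co (D.bu D.uJ D.uJ) (D.bu X Y)) (D.bu C E) by simp [D.buL])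
        ≫ D.coh (D.zt D.uJ D.uJ X Y) (𝟙 _) ≫ D.coh (D.buh a b) (D.buh (𝟙 C) (𝟙 E)) := by
    rw [D.coh_eqToHom_comp, D.buh_id, ← D.coh_comp, Category.comp_id]
  rw [reassoc_of% h, hL]
  simp only [Category.assoc]
  rw [D.zt_nat, reassoc_of% D.zt_assoc1]
  simp [D.buh_comp, D.buh_eqToHom]

/-- The multiplication of `J`. -/
lemma pw : D.JLinear (D.coAct D.pw D.uJ) D.pw D.pw := by
  unfold JLinear coAct
  rw [Category.assoc, D.pw_assoc]
  simp

lemma coA (a : D.co D.uJ X ⟶ X) (B C : M) :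
    D.JLinear (D.coAct (D.coAct a B) C) (D.coAct a (D.co B C)) (eqToHom (D.coA X B C)) := by
  unfold JLinear coAct
  rw [D.coh_eqToHom_comp, D.coh_assoc, D.coh_id, ← eqToHom_refl D.uJ rfl, D.coh_eqToHom]
  simp

end JLinear

end Duo

namespace RWB

open Duo

variable {M : Type u} [Category.{v} M] {D : Duo M} (W : RWB D)

lemma chiR_jLinear {F G : M} {a : D.co D.uJ F ⟶ F} {b : D.co D.uJ G ⟶ G}
    {f : D.co F W.A ⟶ F} {g : D.co G W.A ⟶ G} (hf : D.JLinear (D.coAct a W.A) a f)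
    (hg : D.JLinear (D.coAct b W.A) b g) :
    D.JLinear (D.buAct a b) (D.buAct a b) (W.chiR F G f g) :=
  ((JLinear.coR _).inv (by simp) (by simp)).comp <|
    ((JLinear.id _).coh _).comp <| (JLinear.zt a b _ _).comp (hf.buh hg)

lemma coh_ep_pw_jLinear :
    D.JLinear (D.coAct D.pw W.A) D.pw (D.coh (𝟙 D.uJ) W.ep ≫ D.pw) :=
  ((JLinear.id _).coh _).comp JLinear.pw

lemma jeta_jLinear : D.JLinear D.pw (D.coAct D.pw W.A) W.jeta :=
  ((JLinear.coR _).inv (by simp) (by simp)).comp ((JLinear.id _).coh _)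

lemma sqcapR_jLinear :
    D.JLinear (D.coAct D.pw W.A) (D.coAct D.pw W.A) W.sqcapR := by
  have hJA : D.JLinear (D.coAct (D.coAct D.pw W.A) (D.bu W.A W.A))
      (D.coAct (D.buAct D.pw (D.coAct D.pw W.A)) (D.bu W.A W.A))
      (eqToHom (show D.co W.JA (D.bu W.A W.A)
        = D.co (D.bu D.uJ W.JA) (D.bu W.A W.A) by simp [D.buL])) := by
    have := ((JLinear.buL (D.coAct D.pw W.A)).inv (g := eqToHom (D.buL _).symm)
      (by simp) (by simp)).coh (eqToHom (rfl : D.bu W.A W.A = _))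
    rwa [D.coh_eqToHom] at this
  exact ((JLinear.coR _).inv ((eqToHom_trans _ _).trans (eqToHom_refl _ _))
    ((eqToHom_trans _ _).trans (eqToHom_refl _ _))).comp <|
    ((JLinear.id _).coh _).comp <| hJA.comp <| (JLinear.zt _ _ _ _).comp <|
      ((JLinear.id _).buh ((JLinear.coA _ _ _).comp ((JLinear.id _).coh _))).comp <|
        ((JLinear.id _).buh JLinear.pw).comp (JLinear.buR _)

section Retract

variable {W} {R : M} {p : W.JA ⟶ R} {i : R ⟶ W.JA}

lemma gamJ_eq : W.gamJ R p i = D.coh (𝟙 D.uJ) i ≫ D.coAct D.pw W.A ≫ p :=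
  congrArg (D.coh (𝟙 D.uJ) i ≫ ·) (Category.assoc _ _ _).symm

lemma proj_jLinear (hpi : p ≫ i = W.sqcapR) (hip : i ≫ p = 𝟙 R) :
    D.JLinear (D.coAct D.pw W.A) (W.gamJ R p i) p := by
  rw [gamJ_eq]
  exact W.sqcapR_jLinear.retract_proj hpi hip

lemma incl_jLinear (hpi : p ≫ i = W.sqcapR) (hip : i ≫ p = 𝟙 R) :
    D.JLinear (W.gamJ R p i) (D.coAct D.pw W.A) i := by
  rw [gamJ_eq]
  exact W.sqcapR_jLinear.retract_incl hpi hip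

lemma gamA_jLinear (hpi : p ≫ i = W.sqcapR) (hip : i ≫ p = 𝟙 R) :
    D.JLinear (D.coAct (W.gamJ R p i) W.A) (W.gamJ R p i) (W.gamA R p i) :=
  ((incl_jLinear hpi hip).coh _).comp <| (JLinear.coA _ _ _).comp <|
    ((JLinear.id _).coh _).comp (proj_jLinear hpi hip)

end Retract

end RWB

/-- **Statement 10.**  For a right weak bimonoid `A` in a duoidal category with split
idempotents and a fixed splitting of `⊓^R_∘` through `R_∘`, the retract `R_∘` is a
separable Frobenius monoid in the category of left `J`-modules: each of the four
structure morphisms `μ^R_∘, η^R_∘, Δ^R_∘, ε^R_∘` is a morphism of left `J`-modules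
(`J` acting on `R_∘` by `γ_J`, on `J` by `ϖ`, and on `R_∘•R_∘` by
`(γ_J•γ_J).ζ` precomposed with `J∘(R_∘•R_∘) ≅ (J•J)∘(R_∘•R_∘)`). -/
theorem R_sepFrobenius_in_J_modules
    {M : Type u} [Category.{v} M] (D : Duo M) (W : RWB D)
    (hsplit : SplitIdem M)
    (R : M) (p : W.JA ⟶ R) (i : R ⟶ W.JA)
    (hpi : p ≫ i = W.sqcapR) (hip : i ≫ p = 𝟙 R) :
    -- the left J-action on R_∘•R_∘
    let actJRR : D.co D.uJ (D.bu R R) ⟶ D.bu R R :=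
      eqToHom (show D.co D.uJ (D.bu R R) = D.co (D.bu D.uJ D.uJ) (D.bu R R) by
          simp [D.buL])
        ≫ D.zt D.uJ D.uJ R R ≫ D.buh (W.gamJ R p i) (W.gamJ R p i)
    -- μ^R_∘ is a morphism of left J-modules
    (D.coh (𝟙 D.uJ) (W.muR R p i) ≫ W.gamJ R p i = actJRR ≫ W.muR R p i) ∧
    -- η^R_∘ is a morphism of left J-modules
    (D.coh (𝟙 D.uJ) (W.etaR R p) ≫ W.gamJ R p i = D.pw ≫ W.etaR R p) ∧
    -- Δ^R_∘ is a morphism of left J-modules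
    (D.coh (𝟙 D.uJ) (W.DeltaR R p i) ≫ actJRR = W.gamJ R p i ≫ W.DeltaR R p i) ∧
    -- ε^R_∘ is a morphism of left J-modules
    (D.coh (𝟙 D.uJ) (W.epsR R i) ≫ D.pw = W.gamJ R p i ≫ W.epsR R i) := by
  have hp := RWB.proj_jLinear hpi hip
  have hi := RWB.incl_jLinear hpi hip
  have hA := RWB.gamA_jLinear hpi hip
  have hchi := W.chiR_jLinear hA hA
  have hid := Duo.JLinear.id (W.gamJ R p i)
  exact ⟨hchi.comp <| (hid.buh hi).comp <| (hid.buh ((Duo.JLinear.id _).coh _)).comp <|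
      (hid.buh Duo.JLinear.pw).comp (Duo.JLinear.buR _),
    W.jeta_jLinear.comp hp,
    ((Duo.JLinear.buR _).inv (by simp) (by simp)).comp <|
      (hid.buh W.jeta_jLinear).comp <| (hid.buh hp).comp hchi,
    hi.comp W.coh_ep_pw_jLinear⟩
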